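/- Let W be the Coxeter group of type E₈ on generators s₁,…,s₈ (Bourbaki numbering), and let u = (s₁s₂⋯s₈)^{15} be its longest element, a central involution. Then H²(W/⟨u⟩, ℂˣ) is isomorphic to ℤ/2. -/

import Mathlib

variable (k : Type*) [Field k] (G : Type*) [Group G]

/-- A normalized 2-cocycle on `G` with values in `kˣ` (trivial `G`-action):
`σ(g,h)σ(gh,l) = σ(h,l)σ(g,hl)` and `σ(1,g) = σ(g,1) = 1`. -/
def IsCocycle (σ : G → G → kˣ) : Prop :=
  (∀ g h l : G, σ g h * σ (g * h) l = σ h l * σ g (h * l)) ∧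
    (∀ g : G, σ 1 g = 1) ∧ (∀ g : G, σ g 1 = 1)

/-- A 2-coboundary: `∂γ(g,h) = γ(g)γ(h)γ(gh)⁻¹` for some `γ` with `γ(1) = 1`. -/
def IsCoboundary (σ : G → G → kˣ) : Prop :=
  ∃ γ : G → kˣ, γ 1 = 1 ∧ ∀ g h : G, σ g h = γ g * γ h * (γ (g * h))⁻¹

/-- The group `Z²(G,kˣ)` of 2-cocycles, as a subgroup of the pointwise product group. -/
def Z2 : Subgroup (G → G → kˣ) where
  carrier := {σ | IsCocycle k G σ}
  one_mem' := ⟨fun _ _ _ => by simp, fun _ => rfl, fun _ => rfl⟩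
  mul_mem' := by
    rintro σ ω ⟨hσ1, hσ2, hσ3⟩ ⟨hω1, hω2, hω3⟩
    refine ⟨fun g h l => ?_, fun g => ?_, fun g => ?_⟩
    · simp only [Pi.mul_apply]
      rw [mul_mul_mul_comm, hσ1 g h l, hω1 g h l, mul_mul_mul_comm]
    · simp only [Pi.mul_apply, hσ2 g, hω2 g, one_mul]
    · simp only [Pi.mul_apply, hσ3 g, hω3 g, one_mul]
  inv_mem' := by
    rintro σ ⟨h1, h2, h3⟩
    refine ⟨fun g h l => ?_, fun g => ?_, fun g => ?_⟩
    · simp only [Pi.inv_apply]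
      rw [← mul_inv, ← mul_inv, h1 g h l]
    · simp only [Pi.inv_apply, h2 g, inv_one]
    · simp only [Pi.inv_apply, h3 g, inv_one]

/-- The subgroup `B²(G,kˣ)` of 2-coboundaries inside `Z²(G,kˣ)`. -/
def B2 : Subgroup (Z2 k G) where
  carrier := {σ | IsCoboundary k G (σ : G → G → kˣ)}
  one_mem' := ⟨fun _ => 1, rfl, fun g h => by simp⟩
  mul_mem' := by
    rintro σ ω ⟨γ, hγ1, hγ⟩ ⟨δ, hδ1, hδ⟩
    refine ⟨γ * δ, by simp [hγ1, hδ1], fun g h => ?_⟩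
    show (σ : G → G → kˣ) g h * (ω : G → G → kˣ) g h = _
    rw [hγ g h, hδ g h]
    simp only [Pi.mul_apply, mul_inv]
    ac_rfl
  inv_mem' := by
    rintro σ ⟨γ, hγ1, hγ⟩
    refine ⟨γ⁻¹, by simp [hγ1], fun g h => ?_⟩
    show ((σ : G → G → kˣ) g h)⁻¹ = _
    rw [hγ g h]
    simp only [Pi.inv_apply, mul_inv, inv_inv]

/-- The second cohomology group `H²(G,kˣ) = Z²(G,kˣ)/B²(G,kˣ)` with its usual
(pointwise-multiplication-induced) group structure. -/
abbrev H2 := Z2 k G ⧸ B2 k G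

/-- The relations `(sᵢsⱼ)^{m i j} = 1` of a Coxeter presentation (with `m i i = 1`,
so that the generators are involutions). -/
def coxeterRels {n : ℕ} (m : Fin n → Fin n → ℕ) : Set (FreeGroup (Fin n)) :=
  ⋃ (i : Fin n) (j : Fin n), {(FreeGroup.of i * FreeGroup.of j) ^ m i j}

/-- The Coxeter group presented by the matrix `m`. -/
abbrev CoxGroup {n : ℕ} (m : Fin n → Fin n → ℕ) := PresentedGroup (coxeterRels m)

/-- The simple reflections. -/
def coxS {n : ℕ} (m : Fin n → Fin n → ℕ) (i : Fin n) : CoxGroup m := PresentedGroup.of i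

/-- The Coxeter element `s₁ s₂ ⋯ sₙ`. -/
def coxProd {n : ℕ} (m : Fin n → Fin n → ℕ) : CoxGroup m :=
  (List.ofFn fun i => coxS m i).prod

/-- The edges of the `E₈` Dynkin diagram in Bourbaki numbering (0-indexed). -/
def e8Edges : List (Fin 8 × Fin 8) := [(0, 2), (2, 3), (3, 4), (4, 5), (5, 6), (6, 7), (1, 3)]

/-- The Coxeter matrix of type `E₈` (Bourbaki numbering, 0-indexed). -/
def mE8 : Fin 8 → Fin 8 → ℕ := fun i j =>
  if i = j then 1 else if (i, j) ∈ e8Edges ∨ (j, i) ∈ e8Edges then 3 else 2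

/-! ### Matrices -/

/-- The Cartan matrix of type `E₈`. -/
def e8A : Matrix (Fin 8) (Fin 8) ℤ := fun i j =>
  if i = j then 2 else if mE8 i j = 3 then -1 else 0

/-- The simple reflections in the basis of simple roots. -/
def e8R (i : Fin 8) : Matrix (Fin 8) (Fin 8) ℤ := fun a b =>
  (if a = b then 1 else 0) - (if a = i then e8A i b else 0)

theorem e8A_transpose : e8A.transpose = e8A := by decide +kernel

theorem e8A_symm (i j : Fin 8) : e8A i j = e8A j i := congrFun (congrFun e8A_transpose j) i

theorem e8R_rel (i j : Fin 8) : (e8R i * e8R j) ^ mE8 i j = 1 := by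
  revert i j; decide +kernel

def e8C : Matrix (Fin 8) (Fin 8) ℤ :=
  !![0, 1, 0, 0, 0, 0, 0, -1; 0, 0, 1, 0, 0, 0, 0, -1; 1, 1, 0, 0, 0, 0, 0, -1; 0, 1, 1, 0, 0, 0, 0, -1; 0, 0, 0, 1, 0, 0, 0, -1; 0, 0, 0, 0, 1, 0, 0, -1; 0, 0, 0, 0, 0, 1, 0, -1; 0, 0, 0, 0, 0, 0, 1, -1]
def e8C3 : Matrix (Fin 8) (Fin 8) ℤ :=
  !![1, 1, 0, 0, 0, -1, 0, 0; 0, 1, 1, 0, 0, -1, 0, -1; 1, 1, 1, 0, 0, -1, -1, 0; 1, 2, 1, 0, 0, -1, -1, -1; 1, 1, 1, 0, 0, -1, 0, -1; 0, 1, 1, 0, 0, -1, 0, 0; 0, 0, 0, 1, 0, -1, 0, 0; 0, 0, 0, 0, 1, -1, 0, 0]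
def e8C5 : Matrix (Fin 8) (Fin 8) ℤ :=
  !![1, 1, 1, -1, 0, 0, -1, 0; 1, 2, 1, -1, 0, -1, 0, -1; 1, 2, 2, -1, -1, 0, -1, -1; 2, 3, 2, -1, -1, -1, -1, -1; 1, 2, 2, -1, 0, -1, -1, -1; 1, 2, 1, -1, 0, 0, -1, -1; 1, 1, 1, -1, 0, 0, 0, -1; 0, 1, 1, -1, 0, 0, 0, 0]

theorem e8C3_eq : e8C * e8C * e8C = e8C3 := by decide +kernel
theorem e8C5_eq : e8C3 * e8C * e8C = e8C5 := by decide +kernel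
theorem e8C15_eq : e8C5 * e8C5 * e8C5 = -1 := by decide +kernel

theorem e8C_pow : e8C ^ 15 = -1 := by
  have h3 : e8C ^ 3 = e8C3 := by rw [← e8C3_eq]; noncomm_ring
  have h5 : e8C ^ 5 = e8C5 := by rw [← e8C5_eq, ← h3]; noncomm_ring
  rw [← e8C15_eq, ← h5]; noncomm_ring

theorem e8C_eq : (List.ofFn fun i => e8R i).prod = e8C := by
  have h : e8R 0 * (e8R 1 * e8R 2 * e8R 3) * (e8R 4 * e8R 5 * e8R 6 * e8R 7) = e8C := by
    decide +kernel
  rw [← h]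
  simp [List.ofFn_succ, List.ofFn_zero, mul_assoc]

/-! ### The Clifford algebra -/

/-- The quadratic form with `Q(αᵢ) = 1` on the root space. -/
noncomputable def e8Q : QuadraticForm ℚ (Fin 8 → ℚ) :=
  LinearMap.BilinMap.toQuadraticMap
    (Matrix.toLinearMap₂' ℚ ((1 / 2 : ℚ) • e8A.map (Int.cast : ℤ → ℚ)))

theorem e8Q_polar (i : Fin 8) (x : Fin 8 → ℚ) :
    QuadraticMap.polar e8Q (Pi.single i 1) x = ∑ j, (e8A i j : ℚ) * x j := by
  unfold e8Q
  rw [LinearMap.BilinMap.polar_toQuadraticMap]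
  simp only [Matrix.toLinearMap₂'_apply', Matrix.smul_mulVec,
    dotProduct_smul, Matrix.dotProduct_mulVec x, single_one_dotProduct, dotProduct_single_one]
  simp only [Matrix.mulVec, Matrix.vecMul, dotProduct, Matrix.map_apply, smul_eq_mul]
  rw [← mul_add, ← Finset.sum_add_distrib, Finset.mul_sum]
  refine Finset.sum_congr rfl fun j _ => ?_
  rw [e8A_symm j i]; ring

theorem e8Q_single (i : Fin 8) : e8Q (Pi.single i 1) = 1 := by
  have h := e8Q_polar i (Pi.single i 1)
  rw [QuadraticMap.polar_self] at h
  simp [Pi.single_apply] at h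
  have h2 : (e8A i i : ℚ) = 2 := by simp [e8A]
  rw [h2] at h
  linarith

noncomputable abbrev e8Cl := CliffordAlgebra e8Q

noncomputable def e8p (i : Fin 8) : e8Cl := CliffordAlgebra.ι e8Q (Pi.single i 1)

theorem e8p_sq (i : Fin 8) : e8p i * e8p i = 1 := by
  unfold e8p
  rw [CliffordAlgebra.ι_sq_scalar, e8Q_single, map_one]

theorem e8p_swap (i : Fin 8) (x : Fin 8 → ℚ) :
    e8p i * CliffordAlgebra.ι e8Q x + CliffordAlgebra.ι e8Q x * e8p i
      = algebraMap ℚ _ (∑ j, (e8A i j : ℚ) * x j) := by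
  unfold e8p
  rw [CliffordAlgebra.ι_mul_ι_add_swap, e8Q_polar]

theorem e8p_swap' (i j : Fin 8) :
    e8p i * e8p j + e8p j * e8p i = algebraMap ℚ _ (e8A i j : ℚ) := by
  have := e8p_swap i (Pi.single j 1)
  simpa [Pi.single_apply, e8p] using this

/-- `p` acts on vectors through the integer matrix `M`. -/
def ConjBy (p : e8Cl) (M : Matrix (Fin 8) (Fin 8) ℤ) : Prop :=
  ∀ x : Fin 8 → ℚ, p * CliffordAlgebra.ι e8Q x =
    CliffordAlgebra.ι e8Q ((M.map (Int.cast : ℤ → ℚ)).mulVec x) * p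

theorem ConjBy.mul {p q : e8Cl} {M N : Matrix (Fin 8) (Fin 8) ℤ}
    (h : ConjBy p M) (h' : ConjBy q N) : ConjBy (p * q) (M * N) := by
  intro x
  have e : (M * N).map (Int.cast : ℤ → ℚ) = M.map (Int.cast : ℤ → ℚ) * N.map Int.cast :=
    Matrix.map_mul (f := Int.castRingHom ℚ)
  rw [e, ← Matrix.mulVec_mulVec, mul_assoc, h' x, ← mul_assoc, h, mul_assoc]

theorem ConjBy.one : ConjBy 1 1 := by
  intro x
  simp

theorem ConjBy.pow {p : e8Cl} {M : Matrix (Fin 8) (Fin 8) ℤ}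
    (h : ConjBy p M) (n : ℕ) : ConjBy (p ^ n) (M ^ n) := by
  induction n with
  | zero => simpa using ConjBy.one
  | succ n ih => rw [pow_succ, pow_succ]; exact ih.mul h

theorem e8p_conj (i : Fin 8) : ConjBy (e8p i) (-e8R i) := by
  intro x
  have e : ((-e8R i).map (Int.cast : ℤ → ℚ)).mulVec x =
      (∑ j, (e8A i j : ℚ) * x j) • Pi.single i 1 - x := by
    funext a
    simp only [Matrix.mulVec, dotProduct, Matrix.map_apply, Matrix.neg_apply, e8R, Pi.sub_apply,
      Pi.smul_apply, Pi.single_apply, smul_eq_mul]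
    by_cases h : a = i
    · simp [h, sub_mul, Finset.sum_sub_distrib]
    · simp [h]
  rw [e, map_sub, map_smul, sub_mul, smul_mul_assoc]
  change _ = _ • (e8p i * e8p i) - _
  rw [e8p_sq, ← Algebra.algebraMap_eq_smul_one, ← e8p_swap]
  abel

theorem e8p_prod_conj : ConjBy ((List.ofFn fun i => e8p i).prod) e8C := by
  have h : ConjBy (List.ofFn fun i => e8p i).prod (List.ofFn fun i => -e8R i).prod := by
    simp only [List.ofFn_succ, List.ofFn_zero, List.prod_cons, List.prod_nil]
    repeat' first | apply ConjBy.mul | apply e8p_conj | apply ConjBy.one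
  have e : (List.ofFn fun i => -e8R i).prod = e8C := by
    rw [← e8C_eq]
    simp [List.ofFn_succ, List.ofFn_zero]
  rwa [e] at h

theorem e8p_anti : (List.ofFn fun i => e8p i).prod ^ 15 * e8p 0
    = - (e8p 0 * (List.ofFn fun i => e8p i).prod ^ 15) := by
  have h := e8p_prod_conj.pow 15 (Pi.single 0 1)
  rw [e8C_pow] at h
  have e : ((-1 : Matrix (Fin 8) (Fin 8) ℤ).map (Int.cast : ℤ → ℚ)).mulVec (Pi.single 0 1)
     = - Pi.single 0 1 := by
    have : (-1 : Matrix (Fin 8) (Fin 8) ℤ).map (Int.cast : ℤ → ℚ) = -1 := by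
      ext i j
      simp [Matrix.one_apply, apply_ite]
    rw [this, Matrix.neg_mulVec, Matrix.one_mulVec]
  rw [e, map_neg, neg_mul] at h
  exact h

theorem e8p_braid (i j : Fin 8) (h : e8A i j = -1) :
    e8p i * e8p j * e8p i = e8p j * e8p i * e8p j := by
  have e := e8p_swap' i j
  rw [h] at e
  simp only [Int.cast_neg, Int.cast_one, map_neg, map_one] at e
  have e1 : e8p i * e8p j = -1 - e8p j * e8p i := eq_sub_of_add_eq e
  have e2 : e8p j * e8p i * e8p i = e8p j := by rw [mul_assoc, e8p_sq, mul_one]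
  have e3 : e8p j * e8p i * e8p j = -e8p j - e8p i := by
    rw [mul_assoc, e1, mul_sub, ← mul_assoc, e8p_sq]; simp
  rw [e3, e1, sub_mul, e2]; simp; abel

noncomputable def e8pu (i : Fin 8) : e8Clˣ := ⟨e8p i, e8p i, e8p_sq i, e8p_sq i⟩

theorem pin_exists : ∃ (P : Type) (_ : Group P) (p : Fin 8 → P) (m : P), m ≠ 1 ∧ m * m = 1 ∧
    (∀ x, m * x = x * m) ∧ (∀ i, p i * p i = 1) ∧
    (∀ i j, mE8 i j = 3 → p i * p j * p i = p j * p i * p j) ∧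
    (∀ i j, mE8 i j = 2 → p i * p j = m * (p j * p i)) ∧
    (List.ofFn p).prod ^ 15 * p 0 = m * (p 0 * (List.ofFn p).prod ^ 15) := by
  have hA3 : ∀ i j, mE8 i j = 3 → e8A i j = -1 := by
    intro i j h
    have hne : i ≠ j := by rintro rfl; simp [mE8] at h
    simp [e8A, hne, h]
  have hA2 : ∀ i j, mE8 i j = 2 → e8A i j = 0 := by
    intro i j h
    have hne : i ≠ j := by rintro rfl; simp [mE8] at h
    simp [e8A, hne, h]
  refine ⟨e8Clˣ, inferInstance, e8pu, -1, ?_, by simp, by simp, ?_, ?_, ?_, ?_⟩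
  · intro h
    have h1 : (-1 : e8Cl) = 1 := by simpa using congrArg Units.val h
    have : Invertible (2 : ℚ) := invertibleOfNonzero two_ne_zero
    have h2 : algebraMap ℚ e8Cl 2 = algebraMap ℚ e8Cl 0 := by
      rw [map_ofNat, map_zero, ← one_add_one_eq_two]
      nth_rewrite 1 [← h1]
      simp
    exact two_ne_zero ((algebraMap ℚ e8Cl).injective h2)
  · intro i; ext; exact e8p_sq i
  · intro i j h; ext; exact e8p_braid i j (hA3 i j h)
  · intro i j h; ext
    have e := e8p_swap' i j
    rw [hA2 i j h] at e
    simp only [Int.cast_zero, map_zero] at e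
    have := eq_neg_of_add_eq_zero_left e
    simpa [e8pu] using this
  · ext
    have := e8p_anti
    have e : ((List.ofFn e8pu).prod : e8Cl) = (List.ofFn fun i => e8p i).prod := by
      simp [List.ofFn_succ, List.ofFn_zero, e8pu]
    rw [Units.val_mul, Units.val_pow_eq_pow_val, Units.val_mul, Units.val_mul,
      Units.val_pow_eq_pow_val, e]
    simpa [e8pu] using this

/-! ### Lifting Coxeter generators to a central extension -/

section Lifting

variable {E G : Type*} [Group E] [Group G]

theorem lift_step (π : E →* G) (hsurj : Function.Surjective π)
    (hker : ∀ z, π z = 1 → ∀ x, z * x = x * z) (s t : G)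
    (hst : s * t * s = t * s * t)
    (S : E) (hS : π S = s) (hSS : S * S = 1) :
    ∃ T : E, π T = t ∧ T * T = 1 ∧ S * T * S = T * S * T := by
  obtain ⟨T0, hT0⟩ := hsurj t
  set T : E := (S * T0) * S * (S * T0)⁻¹ with hT
  have hπ : π T = t := by
    simp only [hT, map_mul, map_inv, hS, hT0]
    rw [mul_inv_eq_iff_eq_mul, hst]; group
  have hTT : T * T = 1 := by
    have : T * T = (S * T0) * (S * S) * (S * T0)⁻¹ := by rw [hT]; group
    rw [this, hSS]; group
  refine ⟨T, hπ, hTT, ?_⟩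
  have hz : π (T0 * T⁻¹) = 1 := by rw [map_mul, map_inv, hπ, hT0, mul_inv_cancel]
  have hz' := hker _ hz
  obtain ⟨z, hzT⟩ : ∃ z, z = T0 * T⁻¹ := ⟨_, rfl⟩
  rw [← hzT] at hz'
  have e0 : T0 = z * T := by rw [hzT]; group
  have e1 : T * (S * T0) = (S * T0) * S := by rw [hT]; group
  rw [e0] at e1
  have e2 : T * (S * (z * T)) = z * (T * S * T) := by
    rw [← mul_assoc S, ← hz' S]
    rw [mul_assoc z, ← mul_assoc T z, ← hz' T]; group
  have e3 : S * (z * T) * S = z * (S * T * S) := by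
    rw [← mul_assoc S, ← hz' S]; group
  rw [e2, e3] at e1
  exact (mul_left_cancel e1).symm

theorem eps_eq (A B C y z : E) (hy : ∀ x, y * x = x * y) (hz : ∀ x, z * x = x * z)
    (hBC : B * C * B = C * B * C) (hy2 : A * B = y * (B * A)) (hz2 : A * C = z * (C * A)) :
    y = z := by
  have f : ∀ X Y Z a b c : E, (∀ x, a * x = x * a) → (∀ x, b * x = x * b) →
      (∀ x, c * x = x * c) → A * X = a * (X * A) → A * Y = b * (Y * A) → A * Z = c * (Z * A) →
      A * (X * Y * Z) = a * b * c * (X * Y * Z) * A := by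
    intro X Y Z a b c ha hb hc h1 h2 h3
    calc A * (X * Y * Z) = (A * X) * Y * Z := by group
      _ = a * X * (A * Y) * Z := by rw [h1]; group
      _ = a * (X * b) * Y * (A * Z) := by rw [h2]; group
      _ = a * b * X * (Y * c) * Z * A := by rw [h3, ← hb X]; group
      _ = a * b * (X * c) * Y * Z * A := by rw [← hc Y]; group
      _ = _ := by rw [← hc X]; group
  have h1 := f B C B y z y hy hz hy hy2 hz2 hy2
  have h2 := f C B C z y z hz hy hz hz2 hy2 hz2
  rw [hBC, h2] at h1
  have h3 := mul_right_cancel (mul_right_cancel h1)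
  rw [← hy z] at h3
  rw [mul_assoc, mul_assoc] at h3
  exact (mul_left_cancel (mul_left_cancel h3)).symm

theorem mE8_connected {X : Type*} (e : Fin 8 → Fin 8 → X) (hsymm : ∀ i j, mE8 i j = 2 → e i j = e j i)
    (hstep : ∀ i j k, mE8 i j = 2 → mE8 i k = 2 → mE8 j k = 3 → e i j = e i k) :
    ∀ i j, mE8 i j = 2 → e i j = e 0 7 := by
  have h1 : ∀ i j k, mE8 i j = 2 → mE8 i k = 2 → mE8 k j = 3 → e i j = e i k :=
    fun i j k a b c => (hstep i k j b a c).symm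
  have a6 := h1 0 6 7 (by decide) (by decide) (by decide)
  have a5 := (h1 0 5 6 (by decide) (by decide) (by decide)).trans a6
  have a4 := (h1 0 4 5 (by decide) (by decide) (by decide)).trans a5
  have a3 := (h1 0 3 4 (by decide) (by decide) (by decide)).trans a4
  have a1 := (h1 0 1 3 (by decide) (by decide) (by decide)).trans a3
  have s7 := hsymm 7 0 (by decide)
  have b2 := (h1 7 2 0 (by decide) (by decide) (by decide)).trans s7
  have b3 := (h1 7 3 2 (by decide) (by decide) (by decide)).trans b2
  have b1 := (h1 7 1 3 (by decide) (by decide) (by decide)).trans b3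
  have b4 := (h1 7 4 3 (by decide) (by decide) (by decide)).trans b3
  have b5 := (h1 7 5 4 (by decide) (by decide) (by decide)).trans b4
  have c2 := (hsymm 2 7 (by decide)).trans b2
  have c1 := (hsymm 1 7 (by decide)).trans b1
  have c3 := (hsymm 3 7 (by decide)).trans b3
  have c4 := (hsymm 4 7 (by decide)).trans b4
  have c5 := (hsymm 5 7 (by decide)).trans b5
  have d10 := (hsymm 1 0 (by decide)).trans a1
  have d12 := (h1 1 2 0 (by decide) (by decide) (by decide)).trans d10
  have d16 := (h1 1 6 7 (by decide) (by decide) (by decide)).trans c1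
  have d15 := (h1 1 5 6 (by decide) (by decide) (by decide)).trans d16
  have d14 := (h1 1 4 5 (by decide) (by decide) (by decide)).trans d15
  have d26 := (h1 2 6 7 (by decide) (by decide) (by decide)).trans c2
  have d25 := (h1 2 5 6 (by decide) (by decide) (by decide)).trans d26
  have d24 := (h1 2 4 5 (by decide) (by decide) (by decide)).trans d25
  have d36 := (h1 3 6 7 (by decide) (by decide) (by decide)).trans c3
  have d35 := (h1 3 5 6 (by decide) (by decide) (by decide)).trans d36
  have d46 := (h1 4 6 7 (by decide) (by decide) (by decide)).trans c4
  have key : ∀ i j : Fin 8, i < j → mE8 i j = 2 → e i j = e 0 7 := by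
    intro i j
    fin_cases i <;> fin_cases j <;> intro hlt hij <;>
      first
      | assumption
      | rfl
      | exact absurd hlt (by decide)
      | exact absurd hij (by decide)
  intro i j hij
  rcases lt_trichotomy i j with h | h | h
  · exact key i j h hij
  · subst h; simp [mE8] at hij
  · rw [hsymm i j hij]
    refine key j i h ?_
    revert hij h; revert i j; decide

/-- The relations, in the free group, from any elements satisfying them up to sign. -/
theorem coxeter_of (S : Fin 8 → E) (h1 : ∀ i, S i * S i = 1)
    (h3 : ∀ i j, mE8 i j = 3 → S i * S j * S i = S j * S i * S j)
    (h2 : ∀ i j, mE8 i j = 2 → S i * S j = S j * S i) (i j : Fin 8) :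
    (S i * S j) ^ mE8 i j = 1 := by
  have hm : mE8 i j = 1 ∧ i = j ∨ mE8 i j = 2 ∨ mE8 i j = 3 := by
    revert i j; decide
  rcases hm with ⟨h, rfl⟩ | h | h
  · rw [h, pow_one, h1]
  · rw [h, pow_two]
    nth_rewrite 2 [h2 i j h]
    rw [mul_assoc, ← mul_assoc (S j), h1, one_mul, h1]
  · rw [h]
    have : (S i * S j) ^ 3 = (S i * S j * S i) * (S j * S i * S j) := by
      simp only [pow_succ, pow_zero, one_mul, mul_assoc]
    rw [this, ← h3 i j h]
    have : S i * S j * S i * (S i * S j * S i) = S i * (S j * (S i * S i) * S j) * S i := by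
      simp only [mul_assoc]
    rw [this, h1, mul_one, h1, mul_one, h1]

theorem lift_all (π : E →* G) (hsurj : Function.Surjective π)
    (hker : ∀ z, π z = 1 → ∀ x, z * x = x * z) (s : Fin 8 → G)
    (hs3 : ∀ i j, mE8 i j = 3 → s i * s j * s i = s j * s i * s j)
    (S0 : E) (hS0 : π S0 = s 0) (hSS0 : S0 * S0 = 1) :
    ∃ S : Fin 8 → E, (∀ i, π (S i) = s i) ∧ (∀ i, S i * S i = 1) ∧
      ∀ i j, mE8 i j = 3 → S i * S j * S i = S j * S i * S j := by
  obtain ⟨S2, p2, q2, r02⟩ := lift_step π hsurj hker (s 0) (s 2) (hs3 0 2 (by decide)) S0 hS0 hSS0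
  obtain ⟨S3, p3, q3, r23⟩ := lift_step π hsurj hker (s 2) (s 3) (hs3 2 3 (by decide)) S2 p2 q2
  obtain ⟨S1, p1, q1, r31⟩ := lift_step π hsurj hker (s 3) (s 1) (hs3 3 1 (by decide)) S3 p3 q3
  obtain ⟨S4, p4, q4, r34⟩ := lift_step π hsurj hker (s 3) (s 4) (hs3 3 4 (by decide)) S3 p3 q3
  obtain ⟨S5, p5, q5, r45⟩ := lift_step π hsurj hker (s 4) (s 5) (hs3 4 5 (by decide)) S4 p4 q4
  obtain ⟨S6, p6, q6, r56⟩ := lift_step π hsurj hker (s 5) (s 6) (hs3 5 6 (by decide)) S5 p5 q5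
  obtain ⟨S7, p7, q7, r67⟩ := lift_step π hsurj hker (s 6) (s 7) (hs3 6 7 (by decide)) S6 p6 q6
  refine ⟨![S0, S1, S2, S3, S4, S5, S6, S7], ?_, ?_, ?_⟩
  · intro i; fin_cases i <;> assumption
  · intro i; fin_cases i <;> assumption
  · intro i j
    fin_cases i <;> fin_cases j <;> intro hij <;>
      first
      | exact absurd hij (by decide)
      | assumption
      | (symm; assumption)

theorem mk_coxProd : PresentedGroup.mk (coxeterRels mE8) (List.ofFn fun i => FreeGroup.of i).prod
    = coxProd mE8 := by
  rw [map_list_prod, coxProd, List.map_ofFn]; rfl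

theorem lift_ofFn {H : Type*} [Group H] (f : Fin 8 → H) :
    FreeGroup.lift f (List.ofFn fun i => FreeGroup.of i).prod = (List.ofFn f).prod := by
  rw [map_list_prod, List.map_ofFn]
  congr 2
  funext i
  simp

/-- If the commutation relations of the lifts hold up to a common central sign `ζ` and the lift of
`c ^ 15` commutes with the lift of `s₁`, then `ζ = 1`. -/
theorem sign_trivial (S : Fin 8 → E) (ζ : E) (hζ : ∀ x, ζ * x = x * ζ) (hζ2 : ζ * ζ = 1)
    (h1 : ∀ i, S i * S i = 1)
    (h3 : ∀ i j, mE8 i j = 3 → S i * S j * S i = S j * S i * S j)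
    (h2 : ∀ i j, mE8 i j = 2 → S i * S j = ζ * (S j * S i))
    (hc : (List.ofFn S).prod ^ 15 * S 0 = S 0 * (List.ofFn S).prod ^ 15)
    (hcen : ∀ w : CoxGroup mE8, coxProd mE8 ^ 15 * w = w * coxProd mE8 ^ 15) : ζ = 1 := by
  by_contra hne
  obtain ⟨P, _, p, m, hm1, hmm, hmc, p1, p3, p2, pc⟩ := pin_exists
  let N : Subgroup (E × P) :=
    { carrier := {x | x = 1 ∨ x = (ζ, m)}
      one_mem' := Or.inl rfl
      mul_mem' := by
        rintro a b (rfl | rfl) (rfl | rfl)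
        · left; simp
        · right; simp
        · right; simp
        · left; ext <;> simp [hζ2, hmm]
      inv_mem' := by
        rintro a (rfl | rfl)
        · left; simp
        · right; ext <;> simp [inv_eq_of_mul_eq_one_right hζ2, inv_eq_of_mul_eq_one_right hmm] }
  have hN : N.Normal := by
    refine ⟨?_⟩
    rintro n (rfl | rfl) g
    · left; simp
    · right
      ext
      · simp [← hζ]
      · simp [← hmc]
  let Φ : FreeGroup (Fin 8) →* (E × P) ⧸ N :=
    (QuotientGroup.mk' N).comp (FreeGroup.lift fun i => (S i, p i))
  have hrel : ∀ r ∈ coxeterRels mE8, Φ r = 1 := by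
    intro r hr
    simp only [coxeterRels, Set.mem_iUnion, Set.mem_singleton_iff] at hr
    obtain ⟨i, j, rfl⟩ := hr
    rw [map_pow, map_mul]
    have := coxeter_of (fun i => Φ (FreeGroup.of i)) (E := (E × P) ⧸ N) ?_ ?_ ?_ i j
    · exact this
    · intro i
      simp only [Φ, MonoidHom.comp_apply, FreeGroup.lift_apply_of, ← map_mul, Prod.mk_mul_mk, h1, p1]
      exact map_one _
    · intro i j hij
      simp only [Φ, MonoidHom.comp_apply, FreeGroup.lift_apply_of, ← map_mul, Prod.mk_mul_mk,
        h3 i j hij, p3 i j hij]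
    · intro i j hij
      simp only [Φ, MonoidHom.comp_apply, FreeGroup.lift_apply_of, ← map_mul, Prod.mk_mul_mk,
        h2 i j hij, p2 i j hij]
      rw [← Prod.mk_mul_mk, map_mul]
      have : QuotientGroup.mk' N (ζ, m) = 1 := by
        rw [← MonoidHom.mem_ker, QuotientGroup.ker_mk']; right; rfl
      rw [this, one_mul]
  have hle : Subgroup.normalClosure (coxeterRels mE8) ≤ Φ.ker :=
    Subgroup.normalClosure_le_normal fun r hr => hrel r hr
  set c : FreeGroup (Fin 8) := (List.ofFn fun i => FreeGroup.of i).prod with hcdef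
  have hmem : (c ^ 15 * FreeGroup.of 0) * (FreeGroup.of 0 * c ^ 15)⁻¹ ∈ Φ.ker := by
    apply hle
    rw [← PresentedGroup.mk_eq_one_iff, map_mul, map_inv, mul_inv_eq_one, map_mul, map_mul, map_pow,
      mk_coxProd]
    exact hcen _
  have hmem2 : FreeGroup.lift (fun i => (S i, p i))
      ((c ^ 15 * FreeGroup.of 0) * (FreeGroup.of 0 * c ^ 15)⁻¹) ∈ N := by
    rw [MonoidHom.mem_ker] at hmem
    rw [← QuotientGroup.ker_mk' N, MonoidHom.mem_ker]
    exact hmem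
  have hfst : ∀ x, (FreeGroup.lift (fun i => (S i, p i)) x).1 = FreeGroup.lift S x := by
    intro x
    have : (MonoidHom.fst E P).comp (FreeGroup.lift (fun i => (S i, p i))) = FreeGroup.lift S := by
      ext i; simp
    exact DFunLike.congr_fun this x
  have hsnd : ∀ x, (FreeGroup.lift (fun i => (S i, p i)) x).2 = FreeGroup.lift p x := by
    intro x
    have : (MonoidHom.snd E P).comp (FreeGroup.lift (fun i => (S i, p i))) = FreeGroup.lift p := by
      ext i; simp
    exact DFunLike.congr_fun this x
  have e1 : FreeGroup.lift S ((c ^ 15 * FreeGroup.of 0) * (FreeGroup.of 0 * c ^ 15)⁻¹) = 1 := by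
    rw [map_mul, map_inv, mul_inv_eq_one, map_mul, map_mul, map_pow, hcdef, lift_ofFn,
      FreeGroup.lift_apply_of, hc]
  have e2 : FreeGroup.lift p ((c ^ 15 * FreeGroup.of 0) * (FreeGroup.of 0 * c ^ 15)⁻¹) = m := by
    rw [map_mul, map_inv, mul_inv_eq_iff_eq_mul, map_mul, map_mul, map_pow, hcdef, lift_ofFn,
      FreeGroup.lift_apply_of, pc]
  rcases hmem2 with h | h
  · have := congrArg Prod.snd h
    rw [hsnd, e2] at this
    exact hm1 this
  · have := congrArg Prod.fst h
    rw [hfst, e1] at this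
    exact hne this.symm

theorem coxS_rel (i j : Fin 8) : (coxS mE8 i * coxS mE8 j) ^ mE8 i j = 1 := by
  have : (FreeGroup.of i * FreeGroup.of j) ^ mE8 i j ∈ coxeterRels mE8 := by
    simp only [coxeterRels, Set.mem_iUnion, Set.mem_singleton_iff]
    exact ⟨i, j, rfl⟩
  have := PresentedGroup.one_of_mem this
  rwa [map_pow, map_mul] at this

theorem coxS_sq (i : Fin 8) : coxS mE8 i * coxS mE8 i = 1 := by
  have := coxS_rel i i
  rwa [show mE8 i i = 1 by simp [mE8], pow_one] at this

theorem coxS_inv (i : Fin 8) : (coxS mE8 i)⁻¹ = coxS mE8 i :=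
  inv_eq_of_mul_eq_one_right (coxS_sq i)

theorem coxS_braid (i j : Fin 8) (h : mE8 i j = 3) :
    coxS mE8 i * coxS mE8 j * coxS mE8 i = coxS mE8 j * coxS mE8 i * coxS mE8 j := by
  have e := coxS_rel i j
  rw [h] at e
  have e' : (coxS mE8 i * coxS mE8 j * coxS mE8 i) * (coxS mE8 j * coxS mE8 i * coxS mE8 j) = 1 := by
    rw [← e]; simp only [pow_succ, pow_zero, one_mul, mul_assoc]
  rw [eq_inv_of_mul_eq_one_left e', mul_inv_rev, mul_inv_rev, coxS_inv, coxS_inv, mul_assoc]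

theorem lift_hom (π : E →* G) (hsurj : Function.Surjective π)
    (hker : ∀ z, π z = 1 → ∀ x, z * x = x * z) (q : CoxGroup mE8 →* G)
    (S0 : E) (hS0 : π S0 = q (coxS mE8 0)) (hSS0 : S0 * S0 = 1)
    (hcen : ∀ w : CoxGroup mE8, coxProd mE8 ^ 15 * w = w * coxProd mE8 ^ 15)
    (hq : q (coxProd mE8 ^ 15) = 1) :
    ∃ φ : CoxGroup mE8 →* E, ∀ w, π (φ w) = q w := by
  have hrel := coxS_rel
  have c1' := coxS_inv
  have c3 := coxS_braid
  have c2 : ∀ i j, mE8 i j = 2 → coxS mE8 i * coxS mE8 j = coxS mE8 j * coxS mE8 i := by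
    intro i j h
    have e := hrel i j
    rw [h, pow_two] at e
    rw [eq_inv_of_mul_eq_one_left e, mul_inv_rev, c1', c1']
  obtain ⟨S, hS, hS1, hS3⟩ := lift_all π hsurj hker (fun i => q (coxS mE8 i))
    (fun i j h => by simp only [← map_mul, c3 i j h]) S0 hS0 hSS0
  have hS1' : ∀ i, (S i)⁻¹ = S i := fun i => inv_eq_of_mul_eq_one_right (hS1 i)
  -- the commutation scalars
  obtain ⟨e, he⟩ : ∃ e : Fin 8 → Fin 8 → E, ∀ i j, e i j = S i * S j * (S j * S i)⁻¹ :=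
    ⟨_, fun _ _ => rfl⟩
  have hek : ∀ i j, mE8 i j = 2 → π (e i j) = 1 := by
    intro i j h
    simp only [he, map_mul, map_inv, hS]
    rw [mul_inv_eq_one, ← map_mul, ← map_mul, c2 i j h]
  have hec : ∀ i j, mE8 i j = 2 → ∀ x, e i j * x = x * e i j := fun i j h => hker _ (hek i j h)
  have hee : ∀ i j, S i * S j = e i j * (S j * S i) := by
    intro i j; simp only [he]; group
  have hsym2 : ∀ i j, mE8 i j = 2 → mE8 j i = 2 := by decide
  have he2 : ∀ i j, mE8 i j = 2 → e i j * e i j = 1 := by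
    intro i j h
    have a : S i * S j * S i = e i j * S j := by
      rw [hee i j, mul_assoc, mul_assoc, hS1, mul_one]
    have b : (S i * S j * S i) * (S i * S j * S i) = 1 := by
      have : S i * S j * S i * (S i * S j * S i) = S i * (S j * (S i * S i) * S j) * S i := by
        simp only [mul_assoc]
      rw [this, hS1, mul_one, hS1, mul_one, hS1]
    rw [a, mul_assoc, ← mul_assoc (S j), ← hec i j h (S j), mul_assoc, hS1, mul_one] at b
    exact b
  have hesym : ∀ i j, mE8 i j = 2 → e i j = e j i := by
    intro i j h
    have : e i j * e j i = 1 := by simp only [he]; group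
    rw [← he2 i j h] at this
    exact (mul_left_cancel this).symm
  have hcon := mE8_connected e hesym (fun i j k hij hik hjk =>
    eps_eq (S i) (S j) (S k) (e i j) (e i k) (hec i j hij) (hec i k hik) (hS3 j k hjk)
      (hee i j) (hee i k))
  have hcl : π ((List.ofFn S).prod ^ 15) = 1 := by
    rw [← hq, map_pow, map_pow, map_list_prod, coxProd, map_list_prod, List.map_ofFn, List.map_ofFn]
    congr 3
    funext i
    exact hS i
  have hζ : e 0 7 = 1 := sign_trivial S (e 0 7) (hec 0 7 (by decide)) (he2 0 7 (by decide)) hS1 hS3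
    (fun i j h => by rw [← hcon i j h]; exact hee i j) (hker _ hcl (S 0)) hcen
  have hfin := coxeter_of S hS1 hS3 (fun i j h => by
    have := hee i j
    rwa [hcon i j h, hζ, one_mul] at this)
  have hφ : ∀ r ∈ coxeterRels mE8, FreeGroup.lift S r = 1 := by
    intro r hr
    simp only [coxeterRels, Set.mem_iUnion, Set.mem_singleton_iff] at hr
    obtain ⟨i, j, rfl⟩ := hr
    simpa using hfin i j
  refine ⟨PresentedGroup.toGroup hφ, fun w => ?_⟩
  have : π.comp (PresentedGroup.toGroup hφ) = q := by
    apply PresentedGroup.ext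
    intro i
    rw [MonoidHom.comp_apply, PresentedGroup.toGroup.of]
    exact hS i
  exact DFunLike.congr_fun this w

end Lifting

/-- Characters are trivial on `c ^ 15`. -/
theorem char_trivial (χ : CoxGroup mE8 →* ℂˣ) : χ (coxProd mE8 ^ 15) = 1 := by
  have h3 : ∀ i j, mE8 i j = 3 → χ (coxS mE8 j) = χ (coxS mE8 i) := by
    intro i j h
    have e := congrArg χ (coxS_braid i j h)
    simp only [map_mul] at e
    rw [mul_comm (χ (coxS mE8 j)) (χ (coxS mE8 i)), mul_assoc, mul_assoc] at e
    have e2 := mul_left_cancel e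
    exact (mul_left_cancel e2).symm
  have a2 := h3 0 2 (by decide)
  have a3 := (h3 2 3 (by decide)).trans a2
  have a1 := (h3 3 1 (by decide)).trans a3
  have a4 := (h3 3 4 (by decide)).trans a3
  have a5 := (h3 4 5 (by decide)).trans a4
  have a6 := (h3 5 6 (by decide)).trans a5
  have a7 := (h3 6 7 (by decide)).trans a6
  have hall : ∀ i, χ (coxS mE8 i) = χ (coxS mE8 0) := by
    intro i; fin_cases i <;> first | rfl | assumption
  have hsq : χ (coxS mE8 0) ^ 2 = 1 := by rw [pow_two, ← map_mul, coxS_sq, map_one]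
  have hp : χ (coxProd mE8) = 1 := by
    rw [coxProd, map_list_prod, List.map_ofFn]
    have : (χ ∘ fun i => coxS mE8 i) = fun _ => χ (coxS mE8 0) := funext hall
    rw [this, List.ofFn_const, List.prod_replicate]
    calc χ (coxS mE8 0) ^ 8 = (χ (coxS mE8 0) ^ 2) ^ 4 := by rw [← pow_mul]
      _ = 1 := by rw [hsq, one_pow]
  rw [map_pow, hp, one_pow]

theorem coxProd_pow_ne_one : coxProd mE8 ^ 15 ≠ 1 := by
  intro h
  let r : Fin 8 → (Matrix (Fin 8) (Fin 8) ℤ)ˣ := fun i =>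
    ⟨e8R i, e8R i, by simpa [mE8] using e8R_rel i i, by simpa [mE8] using e8R_rel i i⟩
  have hr : ∀ x ∈ coxeterRels mE8, FreeGroup.lift r x = 1 := by
    intro x hx
    simp only [coxeterRels, Set.mem_iUnion, Set.mem_singleton_iff] at hx
    obtain ⟨i, j, rfl⟩ := hx
    ext1
    simpa [r] using e8R_rel i j
  have e := congrArg (PresentedGroup.toGroup hr) h
  rw [map_one, map_pow, coxProd, map_list_prod, List.map_ofFn] at e
  have e2 : (PresentedGroup.toGroup hr ∘ fun i => coxS mE8 i) = r := by
    funext i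
    exact PresentedGroup.toGroup.of hr
  rw [e2] at e
  have e3 := congrArg Units.val e
  have e4 : ((List.ofFn r).prod : Matrix (Fin 8) (Fin 8) ℤ) = e8C := by
    rw [← e8C_eq]
    simp [List.ofFn_succ, List.ofFn_zero, r]
  rw [Units.val_pow_eq_pow_val, e4, e8C_pow] at e3
  have := congrFun (congrFun e3 0) 0
  simp at this

/-- The central extension attached to a cocycle. -/
def CExt {G : Type*} [Group G] (σ : G → G → ℂˣ) (_ : IsCocycle ℂ G σ) := ℂˣ × G

section Ext
variable {G : Type*} [Group G] {σ : G → G → ℂˣ} (hσ : IsCocycle ℂ G σ)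

instance : Mul (CExt σ hσ) := ⟨fun x y => (x.1 * y.1 * σ x.2 y.2, x.2 * y.2)⟩
instance : One (CExt σ hσ) := ⟨((1 : ℂˣ), (1 : G))⟩
instance : Inv (CExt σ hσ) := ⟨fun x => (x.1⁻¹ * (σ x.2⁻¹ x.2)⁻¹, x.2⁻¹)⟩

theorem cext_mul_def (x y : CExt σ hσ) :
    x * y = ((x.1 * y.1 * σ x.2 y.2, x.2 * y.2) : ℂˣ × G) := rfl

theorem cext_one_def : (1 : CExt σ hσ) = ((1, 1) : ℂˣ × G) := rfl

instance : Group (CExt σ hσ) := Group.ofLeftAxioms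
  (by
    intro x y z
    refine Prod.ext ?_ (mul_assoc x.2 y.2 z.2)
    show x.1 * y.1 * σ x.2 y.2 * z.1 * σ (x.2 * y.2) z.2
      = x.1 * (y.1 * z.1 * σ y.2 z.2) * σ x.2 (y.2 * z.2)
    have := hσ.1 x.2 y.2 z.2
    calc x.1 * y.1 * σ x.2 y.2 * z.1 * σ (x.2 * y.2) z.2
        = x.1 * y.1 * z.1 * (σ x.2 y.2 * σ (x.2 * y.2) z.2) := by
          simp only [mul_assoc, mul_left_comm z.1]
      _ = _ := by rw [this]; simp only [mul_assoc])
  (by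
    intro x
    refine Prod.ext ?_ (one_mul x.2)
    show 1 * x.1 * σ 1 x.2 = x.1
    rw [hσ.2.1, one_mul, mul_one])
  (by
    intro x
    refine Prod.ext ?_ (inv_mul_cancel x.2)
    show x.1⁻¹ * (σ x.2⁻¹ x.2)⁻¹ * x.1 * σ x.2⁻¹ x.2 = 1
    rw [mul_right_comm x.1⁻¹]
    simp)

/-- The projection of the extension. -/
def cextπ : CExt σ hσ →* G where
  toFun x := x.2
  map_one' := rfl
  map_mul' _ _ := rfl

theorem cext_inflation {σ : G → G → ℂˣ} (hσ : IsCocycle ℂ G σ) (q : CoxGroup mE8 →* G)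
    (hcen : ∀ w : CoxGroup mE8, coxProd mE8 ^ 15 * w = w * coxProd mE8 ^ 15)
    (hq : q (coxProd mE8 ^ 15) = 1) :
    ∃ a : CoxGroup mE8 → ℂˣ, a 1 = 1 ∧ ∀ v w, a (v * w) = a v * a w * σ (q v) (q w) := by
  obtain ⟨b, hb⟩ : ∃ b : ℂˣ, b * b = (σ (q (coxS mE8 0)) (q (coxS mE8 0)))⁻¹ := by
    obtain ⟨z, hz⟩ := IsAlgClosed.exists_pow_nat_eq
      (((σ (q (coxS mE8 0)) (q (coxS mE8 0)))⁻¹ : ℂˣ) : ℂ) (n := 2) (by norm_num)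
    have hz0 : z ≠ 0 := by
      rintro rfl
      have := ((σ (q (coxS mE8 0)) (q (coxS mE8 0)))⁻¹ : ℂˣ).ne_zero
      rw [← hz] at this
      simp at this
    refine ⟨Units.mk0 z hz0, ?_⟩
    ext
    rw [← hz, Units.val_mul, Units.val_mk0, pow_two]
  obtain ⟨φ, hφ⟩ := lift_hom (cextπ hσ) (fun g => ⟨((1, g) : ℂˣ × G), rfl⟩)
    (by
      intro z hz x
      have hz' : z.2 = 1 := hz
      refine Prod.ext ?_ ?_
      · show z.1 * x.1 * σ z.2 x.2 = x.1 * z.1 * σ x.2 z.2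
        rw [hz', hσ.2.1, hσ.2.2, mul_comm z.1]
      · show z.2 * x.2 = x.2 * z.2
        rw [hz', one_mul, mul_one])
    q ((b, q (coxS mE8 0)) : ℂˣ × G) rfl
    (by
      refine Prod.ext ?_ ?_
      · show b * b * σ (q (coxS mE8 0)) (q (coxS mE8 0)) = 1
        rw [hb, inv_mul_cancel]
      · show q (coxS mE8 0) * q (coxS mE8 0) = 1
        rw [← map_mul, coxS_sq, map_one]) hcen hq
  refine ⟨fun w => (φ w).1, congrArg Prod.fst (map_one φ), fun v w => ?_⟩
  have h1 : (φ v).2 = q v := hφ v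
  have h2 : (φ w).2 = q w := hφ w
  rw [← h1, ← h2]
  exact congrArg Prod.fst (map_mul φ v w)

end Ext

/-- A cocycle whose inflation is trivialised by a function which is `1` at `u` is a coboundary. -/
theorem coboundary_of {W G : Type*} [Group W] [Group G] (q : W →* G) (hsurj : Function.Surjective q)
    (u : W) (hker : ∀ w, q w = 1 → w = 1 ∨ w = u) (hu : q u = 1) {σ : G → G → ℂˣ}
    (hσ : IsCocycle ℂ G σ) (a : W → ℂˣ)
    (ha1 : a 1 = 1) (ha : ∀ v w, a (v * w) = a v * a w * σ (q v) (q w)) (hau : a u = 1) :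
    IsCoboundary ℂ G σ := by
  have hinv : ∀ v w, q v = q w → a v = a w := by
    intro v w h
    have : q (w⁻¹ * v) = 1 := by rw [map_mul, map_inv, h, inv_mul_cancel]
    rcases hker _ this with h1 | h1
    · rw [inv_mul_eq_one.mp h1]
    · have : v = w * u := by rw [← h1]; group
      rw [this, ha, hau, hu, hσ.2.2, mul_one, mul_one]
  have hs : ∀ g, q (Function.surjInv hsurj g) = g := Function.surjInv_eq hsurj
  refine ⟨fun g => (a (Function.surjInv hsurj g))⁻¹, ?_, fun g h => ?_⟩
  · show (a _)⁻¹ = 1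
    rw [hinv _ 1 (by rw [hs, map_one]), ha1, inv_one]
  · show σ g h = (a _)⁻¹ * (a _)⁻¹ * ((a _)⁻¹)⁻¹
    rw [hinv (Function.surjInv hsurj (g * h)) (Function.surjInv hsurj g * Function.surjInv hsurj h)
      (by rw [map_mul, hs, hs, hs]), ha, hs, hs, inv_inv]
    rw [← mul_inv, inv_mul_cancel_left]

/-- The nontrivial class: the one of the extension `W`. -/
theorem exists_nontrivial {W G : Type*} [Group W] [Group G] (q : W →* G)
    (hsurj : Function.Surjective q)
    (u : W) (hker : ∀ w, q w = 1 → w = 1 ∨ w = u) (hu : q u = 1) (hu1 : u ≠ 1) (hu2 : u * u = 1)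
    (hcen : ∀ w, u * w = w * u) (hchar : ∀ χ : W →* ℂˣ, χ u = 1) :
    ∃ σ : G → G → ℂˣ, IsCocycle ℂ G σ ∧ ¬ IsCoboundary ℂ G σ := by
  classical
  let t : G → W := fun g => if g = 1 then 1 else Function.surjInv hsurj g
  have ht1 : t 1 = 1 := by simp [t]
  have ht : ∀ g, q (t g) = g := by
    intro g
    by_cases h : g = 1
    · rw [h, ht1, map_one]
    · simp [t, h, Function.surjInv_eq hsurj]
  obtain ⟨a, ha⟩ : ∃ a : W → ℂˣ, ∀ w, a w = if w = t (q w) then 1 else -1 := ⟨_, fun _ => rfl⟩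
  have hcase : ∀ w, w = t (q w) ∨ w = t (q w) * u := by
    intro w
    have : q ((t (q w))⁻¹ * w) = 1 := by rw [map_mul, map_inv, ht, inv_mul_cancel]
    rcases hker _ this with h1 | h1
    · left; exact (inv_mul_eq_one.mp h1).symm
    · right; rw [← h1]; group
  have hneu : ∀ w, w * u ≠ w := fun w h => hu1 (by simpa using h)
  have hau : ∀ w, a (w * u) = - a w := by
    intro w
    rw [ha, ha, map_mul, hu, mul_one]
    rcases hcase w with h | h
    · rw [← h]; simp [hu1]
    · have h' : w * u = t (q w) := by
        nth_rewrite 1 [h]; rw [mul_assoc, hu2, mul_one]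
      rw [if_pos h', if_neg, neg_neg]
      intro h''
      exact hneu _ (h'.trans h''.symm)
  have ha1 : a 1 = 1 := by rw [ha, map_one, ht1, if_pos rfl]
  have hf : ∀ v w, a (t (q v) * t (q w)) * (a (t (q v)) * a (t (q w)))⁻¹
      = a (v * w) * (a v * a w)⁻¹ := by
    intro v w
    have e1 : ∀ x y, a (x * u * y) * (a (x * u) * a y)⁻¹ = a (x * y) * (a x * a y)⁻¹ := by
      intro x y
      rw [mul_assoc x, hcen, ← mul_assoc, hau, hau]
      simp
    have e2 : ∀ x y, a (x * (y * u)) * (a x * a (y * u))⁻¹ = a (x * y) * (a x * a y)⁻¹ := by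
      intro x y
      rw [← mul_assoc, hau, hau]
      simp
    have h1 : ∀ y, a (t (q v) * y) * (a (t (q v)) * a y)⁻¹ = a (v * y) * (a v * a y)⁻¹ := by
      intro y
      rcases hcase v with h | h
      · rw [← h]
      · conv_rhs => rw [h]
        rw [e1]
    rw [h1]
    rcases hcase w with h | h
    · rw [← h]
    · conv_rhs => rw [h]
      rw [e2]
  let σ : G → G → ℂˣ := fun g h => a (t g * t h) * (a (t g) * a (t h))⁻¹
  have hσ : ∀ v w, σ (q v) (q w) = a (v * w) * (a v * a w)⁻¹ := hf
  refine ⟨σ, ⟨?_, ?_, ?_⟩, ?_⟩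
  · intro g h l
    obtain ⟨x, rfl⟩ := hsurj g
    obtain ⟨y, rfl⟩ := hsurj h
    obtain ⟨z, rfl⟩ := hsurj l
    rw [← map_mul, ← map_mul, hσ, hσ, hσ, hσ, mul_assoc x y z]
    ext
    push_cast
    field_simp
  · intro g
    simp [σ, ht1, ha1]
  · intro g
    simp [σ, ht1, ha1]
  · rintro ⟨γ, hγ1, hγ⟩
    let χ : W →* ℂˣ :=
      { toFun := fun w => a w * γ (q w)
        map_one' := by simp [ha1, hγ1]
        map_mul' := by
          intro v w
          have h1 := hσ v w
          rw [hγ, ← map_mul] at h1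
          rw [mul_inv_eq_iff_eq_mul] at h1
          have h2 : a (v * w) * γ (q (v * w)) = γ (q v) * γ (q w) * (a v * a w) := by
            rw [h1]
            ext
            push_cast
            field_simp
          rw [h2]
          simp only [mul_assoc, mul_comm, mul_left_comm] }
    have h1 := hchar χ
    have h2 : χ u = a u * γ (q u) := rfl
    have h3 := hau 1
    rw [one_mul, ha1] at h3
    rw [h1, hu, hγ1, h3, mul_one] at h2
    have h4 := congrArg Units.val h2
    norm_num at h4

/-- Let `W` be the Coxeter group of type `E₈` and `u = (s₁⋯s₈)^{15}` its longest
element, a central involution. Then `H²(W/⟨u⟩, ℂˣ) ≅ ℤ/2`. -/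
theorem statement17 (u : CoxGroup mE8) (hu : u = coxProd mE8 ^ 15)
    (hcen : ∀ w, u * w = w * u) (h2 : u ^ 2 = 1)
    [hn : (Subgroup.zpowers u).Normal] :
    Nonempty (H2 ℂ (CoxGroup mE8 ⧸ Subgroup.zpowers u) ≃* Multiplicative (ZMod 2)) := by
  subst hu
  set u := coxProd mE8 ^ 15 with hu
  let q : CoxGroup mE8 →* CoxGroup mE8 ⧸ Subgroup.zpowers u := QuotientGroup.mk' _
  have hsurj : Function.Surjective q := QuotientGroup.mk'_surjective _
  have hqu : q u = 1 := (QuotientGroup.eq_one_iff u).mpr (Subgroup.mem_zpowers u)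
  have hker : ∀ w, q w = 1 → w = 1 ∨ w = u := by
    intro w hw
    have hw' : w ∈ Subgroup.zpowers u := (QuotientGroup.eq_one_iff w).mp hw
    obtain ⟨n, rfl⟩ := Subgroup.mem_zpowers_iff.mp hw'
    have h2' : u ^ (2 : ℤ) = 1 := by exact_mod_cast h2
    rcases Int.even_or_odd' n with ⟨m, rfl | rfl⟩
    · left; rw [zpow_mul, h2', one_zpow]
    · right; rw [zpow_add, zpow_mul, h2', one_zpow, one_mul, zpow_one]
  have hu2 : u * u = 1 := by rw [← pow_two]; exact h2
  have hinf : ∀ σ : CoxGroup mE8 ⧸ Subgroup.zpowers u → CoxGroup mE8 ⧸ Subgroup.zpowers u → ℂˣ,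
      IsCocycle ℂ _ σ → ∃ a : CoxGroup mE8 → ℂˣ, a 1 = 1 ∧
        (∀ v w, a (v * w) = a v * a w * σ (q v) (q w)) ∧ (a u = 1 ∨ a u = -1) := by
    intro σ hσ
    obtain ⟨a, ha1, ha⟩ := cext_inflation hσ q hcen hqu
    refine ⟨a, ha1, ha, ?_⟩
    have h := ha u u
    rw [hu2, ha1, hqu, hσ.2.1, mul_one] at h
    have h' : (a u : ℂ) * a u = 1 := by
      rw [← Units.val_mul, ← h, Units.val_one]
    rcases mul_self_eq_one_iff.mp h' with h | h
    · left; ext; exact h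
    · right; ext; simpa using h
  obtain ⟨σ₀, hσ₀, hn₀⟩ := exists_nontrivial q hsurj u hker hqu coxProd_pow_ne_one hu2 hcen char_trivial
  obtain ⟨b, hb1, hb, hbu⟩ := hinf σ₀ hσ₀
  have hbu' : b u = -1 := hbu.resolve_left fun h =>
    hn₀ (coboundary_of q hsurj u hker hqu hσ₀ b hb1 hb h)
  let x₀ : Z2 ℂ (CoxGroup mE8 ⧸ Subgroup.zpowers u) := ⟨σ₀, hσ₀⟩
  have hx₀ : (QuotientGroup.mk x₀ : H2 ℂ (CoxGroup mE8 ⧸ Subgroup.zpowers u)) ≠ 1 := by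
    intro h
    exact hn₀ ((QuotientGroup.eq_one_iff x₀).mp h)
  have hall : ∀ y : H2 ℂ (CoxGroup mE8 ⧸ Subgroup.zpowers u),
      y = 1 ∨ y = QuotientGroup.mk x₀ := by
    intro y
    obtain ⟨⟨τ, hτ⟩, rfl⟩ := QuotientGroup.mk_surjective y
    obtain ⟨a, ha1, ha, hau⟩ := hinf τ hτ
    rcases hau with hau | hau
    · left
      exact (QuotientGroup.eq_one_iff _).mpr (coboundary_of q hsurj u hker hqu hτ a ha1 ha hau)
    · right
      rw [QuotientGroup.eq]
      refine coboundary_of q hsurj u hker hqu (σ := τ⁻¹ * σ₀)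
        ((Z2 ℂ _).mul_mem ((Z2 ℂ _).inv_mem hτ) hσ₀) (fun w => (a w)⁻¹ * b w) ?_ ?_ ?_
      · simp [ha1, hb1]
      · intro v w
        simp only [ha, hb, Pi.mul_apply, Pi.inv_apply, mul_inv]
        ac_rfl
      · simp [hau, hbu']
  have hcard : Nat.card (H2 ℂ (CoxGroup mE8 ⧸ Subgroup.zpowers u)) = 2 := by
    rw [Nat.card_eq_two_iff]
    refine ⟨1, QuotientGroup.mk x₀, hx₀.symm, ?_⟩
    ext y
    simpa using hall y
  exact ⟨mulEquivOfPrimeCardEq (p := 2) hcard (by simp)⟩
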